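/- Let n ≥ 2, let △ₙ ⊂ ℝⁿ be the convex hull of the stack-sorting iterates of τₙ = 2 3 ⋯ (n−1) n 1, and let P_{n−1} ⊂ ℝ^{n−1} be the (n−1)-dimensional lecture-hall simplex. Then △ₙ and P_{n−1} are integrally equivalent; in particular |t△ₙ ∩ ℤⁿ| = |tP_{n−1} ∩ ℤ^{n−1}| for every nonnegative integer t. -/

import Mathlib

open scoped Pointwise

/-- One pass of the stack-sorting algorithm: `ssAux stack input`, where
`stack` holds the current stack contents, top first.  If the next input
entry exceeds the top of the stack, the top is popped to the output;
otherwise the entry is pushed; at the end the stack is popped entirely. -/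
def ssAux : List ℕ → List ℕ → List ℕ
  | stack, [] => stack
  | [], x :: xs => ssAux [x] xs
  | t :: ts, x :: xs =>
    if t < x then t :: ssAux ts (x :: xs) else ssAux (x :: t :: ts) xs
termination_by stack inp => stack.length + 2 * inp.length

/-- The stack-sorting map `s`: one pass of the stack-sorting algorithm. -/
def stackSort (l : List ℕ) : List ℕ := ssAux [] l

/-- A list of naturals, viewed as a point of `ℝⁿ` (entry `i` is the `i`-th
element of the list). -/
def toPoint (n : ℕ) (l : List ℕ) : Fin n → ℝ := fun i => (l.getD i 0 : ℝ)

/-- The permutation `τₙ = 2 3 ⋯ (n-1) n 1`, as a list. -/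
def tauList (n : ℕ) : List ℕ := List.range' 2 (n - 1) ++ [1]

/-- The point of `ℝⁿ` corresponding to `τₙ = 2 3 ⋯ (n-1) n 1`. -/
noncomputable def tauPt (n : ℕ) : Fin n → ℝ := toPoint n (tauList n)

/-- The set `𝒮^{τₙ} = {s⁰(τₙ), s¹(τₙ), …, s^{n-1}(τₙ)} ⊆ ℝⁿ` of
stack-sorting iterates of `τₙ`, regarded as points of `ℝⁿ`. -/
noncomputable def ssIterates (n : ℕ) : Set (Fin n → ℝ) :=
  Set.range fun i : Fin n => toPoint n (stackSort^[(i : ℕ)] (tauList n))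

/-- The simplex `△ₙ`: the convex hull of the stack-sorting iterates of
`τₙ = 2 3 ⋯ (n-1) n 1`. -/
noncomputable def ssSimplex (n : ℕ) : Set (Fin n → ℝ) :=
  convexHull ℝ (ssIterates n)

/-- `x ∈ ℝⁿ` is a lattice (integer) point if all its coordinates are integers. -/
def IsLatticePt {n : ℕ} (x : Fin n → ℝ) : Prop := ∀ i, ∃ z : ℤ, x i = (z : ℝ)

/-- The number of lattice points of a subset of `ℝⁿ`. -/
noncomputable def lattCount {n : ℕ} (S : Set (Fin n → ℝ)) : ℕ :=
  Set.ncard {x ∈ S | IsLatticePt x}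

/-- The `n`-dimensional lecture-hall simplex
`Pₙ = {x ∈ ℝⁿ : 0 ≤ x₁ ≤ x₂/2 ≤ ⋯ ≤ xₙ/n ≤ 1}` (coordinates `1`-indexed). -/
def lectureHall (n : ℕ) : Set (Fin n → ℝ) :=
  {x | (∀ i : Fin n, (i : ℕ) = 0 → 0 ≤ x i) ∧
    (∀ i j : Fin n, (j : ℕ) = (i : ℕ) + 1 →
      x i / ((i : ℕ) + 1) ≤ x j / ((j : ℕ) + 1)) ∧
    (∀ i : Fin n, (i : ℕ) = n - 1 → x i / (n : ℝ) ≤ 1)}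

/-- The list `2 3 ⋯ (m+1) 1 (m+2) ⋯ (m+r+1)`. -/
def sortStage (m r : ℕ) : List ℕ := List.range' 2 m ++ 1 :: List.range' (m + 2) r

theorem ssAux_singleton_range' (k a : ℕ) (l : List ℕ) :
    ssAux [a] (List.range' (a + 1) k ++ l) = List.range' a k ++ ssAux [a + k] l := by
  induction k generalizing a with
  | zero => simp
  | succ k ih =>
    rw [List.range'_succ, List.range'_succ, List.cons_append, ssAux, if_pos (Nat.lt_succ_self a),
      ssAux, ih, List.cons_append, Nat.add_right_comm, Nat.add_assoc]

theorem stackSort_sortStage (m r : ℕ) :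
    stackSort (sortStage (m + 1) r) = sortStage m (r + 1) := by
  have tail : ssAux [m + 2] (1 :: List.range' (m + 3) r) = 1 :: List.range' (m + 2) (r + 1) := by
    rw [ssAux, if_neg (by omega)]
    cases r with
    | zero => simp [ssAux]
    | succ r =>
      have h := ssAux_singleton_range' (r + 1) (m + 2) []
      rw [List.append_nil] at h
      rw [List.range'_succ, ssAux, if_pos (by omega), ← List.range'_succ, h, ssAux,
        ← List.range'_1_concat]
  rw [sortStage, List.range'_succ, List.cons_append, stackSort, ssAux,
    ssAux_singleton_range', Nat.add_comm 2 m, tail, sortStage]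

theorem iterate_stackSort_sortStage (i m r : ℕ) :
    stackSort^[i] (sortStage (m + i) r) = sortStage m (r + i) := by
  induction i generalizing r with
  | zero => rfl
  | succ i ih =>
    rw [Function.iterate_succ_apply, ← Nat.add_assoc, stackSort_sortStage, ih]
    congr 1
    omega

/-- The entries of the one-line notation of `2 3 ⋯ (m+1) 1 (m+2) ⋯`, indexed from zero. -/
noncomputable def stageEntry (m j : ℕ) : ℝ :=
  if j < m then j + 2 else if j = m then 1 else j + 1

/-- The point of `ℝⁿ` with coordinates `2, 3, …, m+1, 1, m+2, …, n`. -/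
noncomputable def stagePt (n m : ℕ) : Fin n → ℝ := fun j => stageEntry m j

theorem toPoint_sortStage {n m r : ℕ} (h : m + r + 1 = n) :
    toPoint n (sortStage m r) = stagePt n m := by
  funext j
  obtain ⟨j, hj⟩ := j
  simp only [toPoint, sortStage, stagePt, stageEntry]
  rcases lt_trichotomy j m with hjm | rfl | hjm
  · rw [List.getD_append _ _ _ _ (by simpa using hjm)]
    simp [List.getD_eq_getElem?_getD, hjm, add_comm]
  · rw [List.getD_append_right _ _ _ _ (by simp)]
    simp
  · obtain ⟨d, rfl⟩ := Nat.exists_eq_add_of_lt hjm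
    rw [List.getD_append_right _ _ _ _ (by simp; omega)]
    have e : m + d + 1 - m = d + 1 := by omega
    have hd : d < r := by omega
    rw [List.length_range', e, List.getD_cons_succ, if_neg (by omega), if_neg (by omega)]
    simp [List.getD_eq_getElem?_getD, hd]
    ring

theorem ssIterates_eq (n : ℕ) :
    ssIterates n = Set.range fun m : Fin n => stagePt n m := by
  have key (i : Fin n) :
      toPoint n (stackSort^[(i : ℕ)] (tauList n)) = stagePt n (Fin.rev i : Fin n) := by
    have hi := i.isLt
    have e : tauList n = sortStage (n - 1 - i + i) 0 := by
      rw [Nat.sub_add_cancel (by omega)]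
      rfl
    rw [e, iterate_stackSort_sortStage, toPoint_sortStage (by omega), Fin.val_rev]
    congr 1
    omega
  rw [ssIterates, funext key]
  exact Fin.revPerm.surjective.range_comp fun m : Fin n => stagePt n m

/-- The sum of the first `k` coordinates, as a linear functional. -/
noncomputable def partialSum (n k : ℕ) : (Fin n → ℝ) →ₗ[ℝ] ℝ :=
  ∑ j : Fin n, if (j : ℕ) < k then LinearMap.proj j else 0

theorem partialSum_apply (n k : ℕ) (x : Fin n → ℝ) :
    partialSum n k x = ∑ j : Fin n, if (j : ℕ) < k then x j else 0 := by
  rw [partialSum, LinearMap.sum_apply]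
  refine Finset.sum_congr rfl fun j _ => ?_
  split_ifs <;> rfl

@[simp] theorem partialSum_zero (n : ℕ) (x : Fin n → ℝ) : partialSum n 0 x = 0 := by
  simp [partialSum_apply]

theorem partialSum_succ {n : ℕ} (k : Fin n) (x : Fin n → ℝ) :
    partialSum n (k + 1) x = partialSum n k x + x k := by
  have hk : x k = ∑ j : Fin n, if j = k then x j else 0 := by simp
  rw [partialSum_apply, partialSum_apply, hk, ← Finset.sum_add_distrib]
  refine Finset.sum_congr rfl fun j _ => ?_
  rcases lt_trichotomy (j : ℕ) k with h | h | h
  · simp [h, Nat.lt_succ_of_lt h, Fin.ne_of_lt h]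
  · simp [Fin.ext h]
  · simp [h.not_gt, Fin.ne_of_gt h, show ¬ (j : ℕ) < k + 1 by omega]

theorem partialSum_self (n : ℕ) (x : Fin n → ℝ) : partialSum n n x = ∑ j, x j := by
  simp [partialSum_apply]

theorem partialSum_stagePt {n m k : ℕ} (hk : k ≤ n) :
    partialSum n k (stagePt n m) = k * (k + 1) / 2 + if k ≤ m then (k : ℝ) else 0 := by
  induction k with
  | zero => simp
  | succ k ih =>
    rw [partialSum_succ ⟨k, hk⟩, ih (by omega), stagePt, stageEntry]
    rcases lt_trichotomy k m with h | rfl | h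
    · rw [if_pos h.le, if_pos h, if_pos (show k + 1 ≤ m from h)]
      push_cast
      ring
    · simp
      ring
    · rw [if_neg (by omega), if_neg h.not_gt, if_neg h.ne', if_neg (by omega)]
      push_cast
      ring

theorem partialSum_difference {n k : ℕ} (hk : k ≤ n) (Q : ℕ → ℝ) :
    partialSum n k (fun m => Q (m + 1) - Q m) = Q k - Q 0 := by
  induction k with
  | zero => simp
  | succ k ih => rw [partialSum_succ ⟨k, hk⟩, ih (by omega)]; ring

/-- The sum of the coordinates, normalised to be `1` on permutations of `1, …, n`. -/
noncomputable def height (n : ℕ) : (Fin n → ℝ) →ₗ[ℝ] ℝ :=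
  (2 / (n * (n + 1) : ℝ)) • partialSum n n

theorem height_stagePt {n : ℕ} (m : Fin n) : height n (stagePt n m) = 1 := by
  have hn : (n : ℝ) ≠ 0 := Nat.cast_ne_zero.mpr (by have := m.isLt; omega)
  have hn' : (n + 1 : ℝ) ≠ 0 := by positivity
  rw [height, LinearMap.smul_apply, partialSum_stagePt le_rfl, if_neg (by have := m.isLt; omega),
    smul_eq_mul]
  field_simp
  ring

/-- The linear map carrying the stack-sorting simplex onto the lecture-hall simplex. -/
noncomputable def toLectureHall (n : ℕ) : (Fin n → ℝ) →ₗ[ℝ] (Fin (n - 1) → ℝ) :=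
  LinearMap.pi fun k =>
    ((k + 1) * (k + 4) / 2 : ℝ) • height n - partialSum n ((k : ℕ) + 1)

theorem toLectureHall_apply (n : ℕ) (x : Fin n → ℝ) (k : Fin (n - 1)) :
    toLectureHall n x k = (k + 1) * (k + 4) / 2 * height n x - partialSum n (k + 1) x := rfl

theorem toLectureHall_stagePt {n : ℕ} (m : Fin n) (k : Fin (n - 1)) :
    toLectureHall n (stagePt n m) k = if (m : ℕ) ≤ k then (k : ℝ) + 1 else 0 := by
  have hk := k.isLt
  rw [toLectureHall_apply, height_stagePt, partialSum_stagePt (by omega)]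
  push_cast
  by_cases h : (m : ℕ) ≤ k
  · rw [if_pos h, if_neg (by omega)]
    ring
  · rw [if_neg h, if_pos (by omega)]
    ring

theorem convex_lectureHall (n : ℕ) : Convex ℝ (lectureHall n) := by
  intro x hx y hy a b ha hb hab
  refine ⟨fun i hi => ?_, fun i j hij => ?_, fun i hi => ?_⟩ <;>
    simp only [Pi.add_apply, Pi.smul_apply, smul_eq_mul, add_div, mul_div_assoc]
  · have := hx.1 i hi
    have := hy.1 i hi
    positivity
  · have := hx.2.1 i j hij
    have := hy.2.1 i j hij
    gcongr
  · have h₁ := mul_le_mul_of_nonneg_left (hx.2.2 i hi) ha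
    have h₂ := mul_le_mul_of_nonneg_left (hy.2.2 i hi) hb
    linarith

theorem toLectureHall_stagePt_mem {n : ℕ} (m : Fin n) :
    toLectureHall n (stagePt n m) ∈ lectureHall (n - 1) := by
  refine ⟨fun i _ => ?_, fun i j hij => ?_, fun i hi => ?_⟩
  · rw [toLectureHall_stagePt]
    positivity
  · rw [toLectureHall_stagePt, toLectureHall_stagePt]
    have hi : (i + 1 : ℝ) ≠ 0 := by positivity
    have hj : (j + 1 : ℝ) ≠ 0 := by positivity
    split_ifs
    · rw [div_self hi, div_self hj]
    · omega
    · rw [zero_div]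
      positivity
    · simp
  · have hn : ((n - 1 : ℕ) : ℝ) = i + 1 := by
      have := i.isLt
      exact_mod_cast (by omega : n - 1 = (i : ℕ) + 1)
    rw [toLectureHall_stagePt, hn]
    refine div_le_one_of_le₀ ?_ (by positivity)
    split_ifs
    · exact le_rfl
    · positivity

theorem lectureHall_subset_image {n : ℕ} (hn : 2 ≤ n) :
    lectureHall (n - 1) ⊆ toLectureHall n '' ssSimplex n := by
  rintro y ⟨hy₀, hy, hy₁⟩
  obtain ⟨Q, hQ₀, hQ, hQn⟩ : ∃ Q : ℕ → ℝ, Q 0 = 0 ∧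
      (∀ k : Fin (n - 1), Q (k + 1) = y k / ((k : ℕ) + 1)) ∧ Q n = 1 := by
    refine ⟨fun k => if k = 0 then 0 else if h : k - 1 < n - 1 then y ⟨k - 1, h⟩ / k else 1,
      by simp, fun k => by simp, ?_⟩
    simp only [show n ≠ 0 by omega, lt_irrefl, if_false, dif_neg, not_false_eq_true]
  have hQ_step (m : Fin n) : 0 ≤ Q (m + 1) - Q m := by
    obtain ⟨m, hm⟩ := m
    rw [sub_nonneg]
    rcases Nat.eq_zero_or_pos m with rfl | hm₀
    · have h := hQ ⟨0, by omega⟩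
      have := hy₀ ⟨0, by omega⟩ rfl
      simp only [zero_add] at h ⊢
      rw [hQ₀, h]
      positivity
    · obtain ⟨k, rfl⟩ := Nat.exists_eq_add_of_lt hm₀
      simp only [zero_add] at hm ⊢
      have hk := hQ ⟨k, by omega⟩
      rcases Nat.lt_or_ge (k + 1) (n - 1) with h | h
      · have hk' := hQ ⟨k + 1, h⟩
        simp only at hk hk'
        rw [hk, hk']
        exact hy ⟨k, by omega⟩ ⟨k + 1, h⟩ rfl
      · obtain rfl : n = k + 1 + 1 := by omega
        simp only at hk
        rw [hQn, hk]
        simpa using hy₁ ⟨k, by omega⟩ rfl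
  refine ⟨∑ m : Fin n, (Q (m + 1) - Q m) • stagePt n m, ?_, ?_⟩
  · refine (convex_convexHull ℝ _).sum_mem (fun m _ => hQ_step m) ?_ fun m _ => ?_
    · rw [← partialSum_self, partialSum_difference le_rfl, hQn, hQ₀, sub_zero]
    · exact subset_convexHull ℝ _ (ssIterates_eq n ▸ Set.mem_range_self m)
  · funext k
    have hk := partialSum_difference (show (k : ℕ) + 1 ≤ n by omega) Q
    rw [partialSum_apply, hQ, hQ₀, sub_zero] at hk
    have hk₀ : (k + 1 : ℝ) ≠ 0 := by positivity
    rw [map_sum, Finset.sum_apply]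
    simp only [map_smul, Pi.smul_apply, smul_eq_mul, toLectureHall_stagePt]
    rw [← div_mul_cancel₀ (y k) hk₀, ← hk, Finset.sum_mul]
    refine Finset.sum_congr rfl fun m _ => ?_
    simp only [Nat.lt_succ_iff]
    split_ifs <;> simp

theorem image_ssSimplex {n : ℕ} (hn : 2 ≤ n) :
    toLectureHall n '' ssSimplex n = lectureHall (n - 1) := by
  refine Set.Subset.antisymm ?_ (lectureHall_subset_image hn)
  rw [Set.image_subset_iff, ssSimplex, ssIterates_eq]
  refine convexHull_min ?_ ((convex_lectureHall _).linear_preimage _)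
  rintro _ ⟨m, rfl⟩
  exact toLectureHall_stagePt_mem m

theorem height_eq_one {n : ℕ} {x : Fin n → ℝ} (hx : x ∈ ssSimplex n) : height n x = 1 := by
  have h : ssSimplex n ⊆ height n ⁻¹' {1} := by
    rw [ssSimplex, ssIterates_eq]
    refine convexHull_min ?_ ((convex_singleton _).linear_preimage _)
    rintro _ ⟨m, rfl⟩
    exact height_stagePt m
  exact h hx

theorem height_eq_of_mem_smul {n : ℕ} {t : ℝ} {x : Fin n → ℝ} (hx : x ∈ t • ssSimplex n) :
    height n x = t := by
  obtain ⟨z, hz, rfl⟩ := hx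
  simp [height_eq_one hz]

theorem partialSum_eq_of_height {n k : ℕ} {t : ℝ} {x : Fin n → ℝ} (hx : height n x = t)
    (hk : k + 1 < n) :
    partialSum n (k + 1) x =
      (k + 1) * (k + 4) / 2 * t - toLectureHall n x ⟨k, by omega⟩ := by
  rw [toLectureHall_apply, hx]
  simp

theorem partialSum_self_eq_of_height {n : ℕ} {t : ℝ} {x : Fin n → ℝ} (hx : height n x = t) :
    partialSum n n x = n * (n + 1) / 2 * t := by
  rcases Nat.eq_zero_or_pos n with rfl | hn
  · simp
  · rw [← hx, height, LinearMap.smul_apply, smul_eq_mul]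
    field_simp

theorem ext_partialSum {n : ℕ} {x y : Fin n → ℝ}
    (h : ∀ k ≤ n, partialSum n k x = partialSum n k y) : x = y := by
  funext k
  have hx := partialSum_succ k x
  have hy := partialSum_succ k y
  rw [h _ k.isLt.le, h _ k.isLt] at hx
  linarith

theorem isLatticePt_iff_partialSum {n : ℕ} {x : Fin n → ℝ} :
    IsLatticePt x ↔ ∀ k ≤ n, ∃ z : ℤ, partialSum n k x = z := by
  constructor
  · intro h k
    induction k with
    | zero => exact fun _ => ⟨0, by simp⟩
    | succ k ih =>
      intro hk
      obtain ⟨a, ha⟩ := ih (by omega)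
      obtain ⟨b, hb⟩ := h ⟨k, hk⟩
      exact ⟨a + b, by rw [partialSum_succ ⟨k, hk⟩, ha, hb]; push_cast; rfl⟩
  · intro h k
    obtain ⟨a, ha⟩ := h k k.isLt.le
    obtain ⟨b, hb⟩ := h (k + 1) k.isLt
    refine ⟨b - a, ?_⟩
    have := partialSum_succ k x
    push_cast
    linarith

theorem toLectureHall_injOn_height (n : ℕ) (t : ℝ) :
    Set.InjOn (toLectureHall n) {x | height n x = t} := by
  intro x hx y hy hxy
  refine ext_partialSum fun k hk => ?_
  rcases hk.eq_or_lt with rfl | hk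
  · rw [partialSum_self_eq_of_height hx, partialSum_self_eq_of_height hy]
  · cases k with
    | zero => simp
    | succ k => rw [partialSum_eq_of_height hx hk, partialSum_eq_of_height hy hk, hxy]

theorem exists_int_cast_half_mul (k : ℕ) :
    (∃ z : ℤ, (k * (k + 1) / 2 : ℝ) = z) ∧ ∃ z : ℤ, ((k + 1) * (k + 4) / 2 : ℝ) = z := by
  obtain ⟨r, hr⟩ := Nat.even_mul_succ_self k
  have hr' : (k * (k + 1) : ℝ) = r + r := by exact_mod_cast hr
  refine ⟨⟨r, ?_⟩, ⟨r + 2 * k + 2, ?_⟩⟩ <;> push_cast <;> linarith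

theorem isLatticePt_toLectureHall {n t : ℕ} {x : Fin n → ℝ} (hx : height n x = t) :
    IsLatticePt (toLectureHall n x) ↔ IsLatticePt x := by
  rw [isLatticePt_iff_partialSum (x := x)]
  constructor
  · intro h k hk
    rcases hk.eq_or_lt with rfl | hk
    · obtain ⟨c, hc⟩ := (exists_int_cast_half_mul k).1
      exact ⟨c * t, by rw [partialSum_self_eq_of_height hx, hc]; push_cast; rfl⟩
    · cases k with
      | zero => exact ⟨0, by simp⟩
      | succ k =>
        obtain ⟨c, hc⟩ := (exists_int_cast_half_mul k).2
        obtain ⟨z, hz⟩ := h ⟨k, by omega⟩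
        exact ⟨c * t - z, by rw [partialSum_eq_of_height hx hk, hc, hz]; push_cast; rfl⟩
  · intro h k
    obtain ⟨c, hc⟩ := (exists_int_cast_half_mul k).2
    obtain ⟨z, hz⟩ := h (k + 1) (by omega)
    exact ⟨c * t - z, by rw [toLectureHall_apply, hx, hc, hz]; push_cast; rfl⟩

theorem toLectureHall_bijOn {n : ℕ} (hn : 2 ≤ n) (t : ℕ) :
    Set.BijOn (toLectureHall n)
      {x ∈ (t : ℝ) • ssSimplex n | IsLatticePt x}
      {x ∈ (t : ℝ) • lectureHall (n - 1) | IsLatticePt x} := by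
  have himage : toLectureHall n '' ((t : ℝ) • ssSimplex n) = (t : ℝ) • lectureHall (n - 1) := by
    rw [image_smul_set, image_ssSimplex hn]
  refine ⟨fun x hx => ⟨himage ▸ Set.mem_image_of_mem _ hx.1, ?_⟩, ?_, ?_⟩
  · exact (isLatticePt_toLectureHall (height_eq_of_mem_smul hx.1)).2 hx.2
  · exact (toLectureHall_injOn_height n t).mono fun x hx => height_eq_of_mem_smul hx.1
  · rintro y ⟨hy, hy_int⟩
    obtain ⟨x, hx, rfl⟩ := himage.symm ▸ hy
    exact ⟨x, ⟨hx, (isLatticePt_toLectureHall (height_eq_of_mem_smul hx)).1 hy_int⟩, rfl⟩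

/-- For `n ≥ 2`, the simplex `△ₙ ⊆ ℝⁿ` (convex hull of
the stack-sorting iterates of `τₙ = 2 3 ⋯ (n-1) n 1`) and the
`(n-1)`-dimensional lecture-hall simplex `P_{n-1} ⊆ ℝ^{n-1}` are integrally
equivalent: there is an affine map restricting, for every nonnegative
integer `t`, to a bijection between the integer points of `t△ₙ` and those
of `tP_{n-1}`; in particular `|t△ₙ ∩ ℤⁿ| = |tP_{n-1} ∩ ℤ^{n-1}|` for all
`t`. -/
theorem ssSimplex_integrallyEquivalent_lectureHall (n : ℕ) (hn : 2 ≤ n) :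
    (∃ φ : (Fin n → ℝ) →ᵃ[ℝ] (Fin (n - 1) → ℝ),
      ∀ t : ℕ, Set.BijOn φ
        {x ∈ (t : ℝ) • ssSimplex n | IsLatticePt x}
        {x ∈ (t : ℝ) • lectureHall (n - 1) | IsLatticePt x}) ∧
    ∀ t : ℕ,
      lattCount ((t : ℝ) • ssSimplex n) =
        Set.ncard {x ∈ (t : ℝ) • lectureHall (n - 1) | IsLatticePt x} := by
  refine ⟨⟨(toLectureHall n).toAffineMap, toLectureHall_bijOn hn⟩, fun t => ?_⟩
  have h := toLectureHall_bijOn hn t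
  rw [lattCount, ← h.image_eq, h.injOn.ncard_image]
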